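/- Every injective Lie algebra endomorphism of the Lie algebra u_n of unitriangular polynomial derivations is an automorphism (i.e., is surjective). -/

import Mathlib

open MvPolynomial

noncomputable section

/-- The polynomial algebra `Pₙ = K[x₀,…,x_{n-1}]`. -/
abbrev Pn (K : Type) [Field K] (n : ℕ) : Type := MvPolynomial (Fin n) K

/-- The Lie algebra of `K`-derivations of `Pₙ`. -/
abbrev DerPn (K : Type) [Field K] (n : ℕ) : Type :=
  Derivation K (Pn K n) (Pn K n)

/-- The subalgebra `P_j = K[x₀,…,x_{j-1}]` of `Pₙ` (0-indexed: variables with index `< j`). -/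
def Psub (K : Type) [Field K] (n j : ℕ) : Subalgebra K (Pn K n) :=
  MvPolynomial.supported K {k : Fin n | (k : ℕ) < j}

/-- The subspace `u_{n,i} = Σ_{j=i}^n P_{j-1}∂_j` (1-indexed `i`; `U K n 1 = u_n`).
A derivation `D` lies in it iff `D(x_j) ∈ P_{j-1}` for all `j` and `D(x_j) = 0` for `j < i`
(0-indexed: `D (X j) = 0` when `(j:ℕ)+1 < i`). -/
def U (K : Type) [Field K] (n i : ℕ) : Submodule K (DerPn K n) where
  carrier := {D | ∀ j : Fin n, D (X j) ∈ Psub K n j ∧ ((j : ℕ) + 1 < i → D (X j) = 0)}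
  add_mem' := by
    intro a b ha hb j
    refine ⟨?_, fun h => ?_⟩
    · simpa using Subalgebra.add_mem _ (ha j).1 (hb j).1
    · simp [(ha j).2 h, (hb j).2 h]
  zero_mem' := by
    intro j
    refine ⟨by simpa using (Psub K n j).zero_mem, fun _ => rfl⟩
  smul_mem' := by
    intro c a ha j
    refine ⟨?_, fun h => ?_⟩
    · simpa using Subalgebra.smul_mem _ (ha j).1 c
    · simp [(ha j).2 h]

/-- The span of all brackets `⁅a,b⁆` with `a ∈ A`, `b ∈ B`. -/
def lieSpan (K : Type) [Field K] (n : ℕ) (A B : Submodule K (DerPn K n)) :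
    Submodule K (DerPn K n) :=
  Submodule.span K {x | ∃ a ∈ A, ∃ b ∈ B, x = ⁅a, b⁆}

/-- The derived series of a subspace `G`: `G_{(0)} = G`, `G_{(i+1)} = [G_{(i)}, G_{(i)}]`. -/
def derivedSub (K : Type) [Field K] (n : ℕ) (G : Submodule K (DerPn K n)) : ℕ → Submodule K (DerPn K n)
  | 0 => G
  | i + 1 => lieSpan K n (derivedSub K n G i) (derivedSub K n G i)

/-- A filtration argument: suppose the coordinates `c β`, indexed by a well-order, are jointly
injective and finitely supported, and that the operators `d a` strictly lower the filtration by
leading index and detect it. Then an injective linear map intertwining the operators is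
surjective. -/
theorem surjective_of_intertwining {K V ι A : Type*} [Field K] [AddCommGroup V] [Module K V]
    [LinearOrder ι] [WellFoundedLT ι] (c : ι → V →ₗ[K] K)
    (hfin : ∀ p, {β | c β p ≠ 0}.Finite) (hinj : ∀ p, (∀ β, c β p = 0) → p = 0)
    (d : A → V → V)
    (hlower : ∀ a α p, (∀ β, c β p ≠ 0 → β ≤ α) → ∀ β, c β (d a p) ≠ 0 → β < α)
    (hdetect : ∀ α p, (∀ a β, c β (d a p) ≠ 0 → β < α) → ∀ β, c β p ≠ 0 → β ≤ α)
    (f : V →ₗ[K] V) (hf : Function.Injective f)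
    (hd : ∀ a, ∃ b, ∀ p, d a (f p) = f (d b p)) : Function.Surjective f := by
  have lead : ∀ p, p = 0 ∨ ∃ α, c α p ≠ 0 ∧ ∀ β, c β p ≠ 0 → β ≤ α := by
    intro p
    rcases Set.eq_empty_or_nonempty {β | c β p ≠ 0} with h | h
    · left
      refine hinj p fun β => ?_
      by_contra hβ
      exact (h ▸ (show β ∈ {β | c β p ≠ 0} from hβ) : β ∈ (∅ : Set ι))
    · obtain ⟨α, hα, hmax⟩ := Set.exists_max_image _ id (hfin p) h
      exact Or.inr ⟨α, hα, hmax⟩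
  have key : ∀ α p, (∀ β, c β p ≠ 0 → β ≤ α) →
      (∀ β, c β (f p) ≠ 0 → β ≤ α) ∧ ∃ q, (∀ β, c β q ≠ 0 → β ≤ α) ∧ f q = p := by
    intro α
    induction α using WellFoundedLT.induction with
    | ind α ih =>
    have ihlt : ∀ p, (∀ β, c β p ≠ 0 → β < α) →
        (∀ β, c β (f p) ≠ 0 → β < α) ∧ ∃ q, (∀ β, c β q ≠ 0 → β < α) ∧ f q = p := by
      intro p hp
      rcases lead p with rfl | ⟨γ, hγ, hmax⟩
      · exact ⟨by simp, 0, by simp, by simp⟩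
      · obtain ⟨h₁, q, h₂, h₃⟩ := ih γ (hp γ hγ) p hmax
        exact ⟨fun β hβ => (h₁ β hβ).trans_lt (hp γ hγ),
          q, fun β hβ => (h₂ β hβ).trans_lt (hp γ hγ), h₃⟩
    have maps : ∀ p, (∀ β, c β p ≠ 0 → β ≤ α) → ∀ β, c β (f p) ≠ 0 → β ≤ α := by
      intro p hp
      refine hdetect α _ fun a => ?_
      obtain ⟨b, hb⟩ := hd a
      rw [hb]
      exact (ihlt _ (hlower b α p hp)).1
    intro p hp
    refine ⟨maps p hp, ?_⟩
    by_cases hex : ∃ e, (∀ β, c β e ≠ 0 → β ≤ α) ∧ c α e ≠ 0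
    · obtain ⟨e, he, hne⟩ := hex
      have hfe : c α (f e) ≠ 0 := by
        intro h0
        obtain ⟨-, q, hq, hqe⟩ := ihlt (f e) fun β hβ =>
          lt_of_le_of_ne (maps e he β hβ) (by rintro rfl; exact hβ h0)
        rw [← hf hqe] at hne
        exact lt_irrefl _ (hq α hne)
      obtain ⟨-, q, hq, hqe⟩ := ihlt (p - (c α p / c α (f e)) • f e) fun β hβ => by
        refine lt_of_le_of_ne ?_ ?_
        · by_contra hle
          refine hβ ?_
          have h₁ : c β p = 0 := by_contra fun h => hle (hp β h)
          have h₂ : c β (f e) = 0 := by_contra fun h => hle (maps e he β h)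
          simp [h₁, h₂]
        · rintro rfl
          exact hβ (by simp [hfe])
      refine ⟨q + (c α p / c α (f e)) • e, fun β hβ => ?_, by simp [hqe]⟩
      by_contra hle
      refine hβ ?_
      have h₁ : c β q = 0 := by_contra fun h => hle (hq β h).le
      have h₂ : c β e = 0 := by_contra fun h => hle (he β h)
      simp [h₁, h₂]
    · obtain ⟨-, q, hq, hqp⟩ := ihlt p fun β hβ =>
        lt_of_le_of_ne (hp β hβ) (by rintro rfl; exact hex ⟨p, hp, hβ⟩)
      exact ⟨q, fun β hβ => (hq β hβ).le, hqp⟩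
  intro p
  rcases lead p with rfl | ⟨α, -, hα⟩
  · exact ⟨0, map_zero f⟩
  · obtain ⟨-, q, -, hq⟩ := key α p hα
    exact ⟨q, hq⟩

section Polynomials

variable {K : Type} [Field K] {n : ℕ}

theorem mem_Psub_iff {j : ℕ} {p : Pn K n} :
    p ∈ Psub K n j ↔ ∀ m, coeff m p ≠ 0 → ∀ k : Fin n, m k ≠ 0 → (k : ℕ) < j := by
  simp only [Psub, mem_supported, Set.subset_def, Finset.mem_coe, mem_vars_iff_mem_support, Set.mem_ofPred_eq,
    mem_support_iff, Finsupp.mem_support_iff]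
  grind

theorem Psub_mono {i j : ℕ} (h : i ≤ j) : Psub K n i ≤ Psub K n j :=
  supported_mono fun _ hk => lt_of_lt_of_le hk h

theorem X_mem_Psub {k : Fin n} {j : ℕ} (h : (k : ℕ) < j) : (X k : Pn K n) ∈ Psub K n j :=
  X_mem_supported.2 h

theorem monomial_mem_Psub {m : Fin n →₀ ℕ} {j : ℕ} (h : ∀ k, m k ≠ 0 → (k : ℕ) < j) (r : K) :
    (monomial m r : Pn K n) ∈ Psub K n j := by
  classical
  refine mem_Psub_iff.2 fun m' hm' => ?_
  rw [coeff_monomial] at hm'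
  have : m = m' := by_contra fun hne => hm' (if_neg hne)
  exact this ▸ h

theorem derivation_mem_Psub {D : DerPn K n} (hD : ∀ j : Fin n, D (X j) ∈ Psub K n j) {j : ℕ}
    {p : Pn K n} (hp : p ∈ Psub K n j) : D p ∈ Psub K n j := by
  rw [Psub, supported_eq_adjoin_X] at hp
  induction hp using Algebra.adjoin_induction with
  | mem x hx =>
    obtain ⟨k, hk, rfl⟩ := hx
    exact Psub_mono (le_of_lt hk) (hD k)
  | algebraMap r => simp
  | add x y _ _ hx hy => simpa using add_mem hx hy
  | mul x y hx' hy' hx hy =>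
    rw [D.leibniz]
    exact add_mem (mul_mem hx' hy) (mul_mem hy' hx)

theorem derivation_eq_zero_of_mem_Psub {D : DerPn K n} {j : ℕ}
    (hD : ∀ k : Fin n, (k : ℕ) < j → D (X k) = 0) {p : Pn K n} (hp : p ∈ Psub K n j) :
    D p = 0 :=
  derivation_eqOn_supported (D₂ := 0) (fun k hk => hD k hk) hp

theorem derivation_eq_sum (D : DerPn K n) (p : Pn K n) :
    D p = ∑ k, D (X k) * pderiv k p := by
  have h : ∀ q : Pn K n, (∑ k, D (X k) • pderiv (R := K) k) q = ∑ k, D (X k) * pderiv k q := by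
    intro q
    rw [← Derivation.coeFnAddMonoidHom_apply, map_sum, Finset.sum_apply]
    simp
  have hD : D = ∑ k, D (X k) • pderiv (R := K) k := by
    refine derivation_ext fun j => ?_
    rw [h, Finset.sum_eq_single j] <;> simp +contextual [eq_comm]
  rw [← h, ← hD]

theorem pderiv_eq_zero_of_mem_Psub {i : Fin n} {p : Pn K n} (hp : p ∈ Psub K n i) :
    pderiv i p = 0 :=
  derivation_eq_zero_of_mem_Psub (D := pderiv i)
    (fun k hk => pderiv_X_of_ne (by rintro rfl; exact lt_irrefl _ hk)) hp

theorem exists_pderiv_eq [CharZero K] {i : Fin n} {j : ℕ} (hij : (i : ℕ) < j) {g : Pn K n}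
    (hg : g ∈ Psub K n j) : ∃ h ∈ Psub K n j, pderiv i h = g := by
  refine ⟨∑ m ∈ g.support, monomial (m + Finsupp.single i 1) (coeff m g / (m i + 1)),
    sum_mem fun m hm => monomial_mem_Psub (fun k hk => ?_) _, ?_⟩
  · by_cases hki : k = i
    · exact hki ▸ hij
    · refine mem_Psub_iff.1 hg m (mem_support_iff.1 hm) k ?_
      simpa [Finsupp.single_apply, Ne.symm hki] using hk
  · conv_rhs => rw [g.as_sum]
    rw [map_sum]
    refine Finset.sum_congr rfl fun m _ => ?_
    rw [pderiv_monomial]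
    have : (m i : K) + 1 ≠ 0 := Nat.cast_add_one_ne_zero _
    simp [this]

/-- The derivation `g ∂ᵢ`. -/
def smulPartial (i : Fin n) : Pn K n →ₗ[K] DerPn K n where
  toFun g := g • pderiv i
  map_add' := by simp [add_smul]
  map_smul' := by simp

@[simp]
theorem smulPartial_apply (i : Fin n) (g p : Pn K n) : smulPartial i g p = g * pderiv i p := rfl

theorem smulPartial_X_mem_Psub {i : Fin n} {g : Pn K n} (hg : g ∈ Psub K n i) (j : Fin n) :
    smulPartial i g (X j) ∈ Psub K n j := by
  by_cases h : j = i
  · subst h; simpa using hg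
  · simp [pderiv_X_of_ne h]

theorem toColex_lt_single {m : Fin n →₀ ℕ} {k : Fin n} (h : ∀ j, m j ≠ 0 → (j : ℕ) < k) :
    toColex m < toColex (Finsupp.single k 1) := by
  refine Finsupp.Colex.lt_iff.2 ⟨k, fun j hj => ?_, ?_⟩
  · have : m j = 0 := by_contra fun h0 => absurd (h j h0) (not_lt.2 (le_of_lt hj))
    simp [this, (ne_of_gt hj).symm]
  · have : m k = 0 := by_contra fun h0 => lt_irrefl _ (h k h0)
    simp [this]

/-- A unitriangular derivation strictly lowers the leading exponent. -/
theorem toColex_lt_of_coeff_derivation {D : DerPn K n}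
    (hD : ∀ j : Fin n, D (X j) ∈ Psub K n j) {α : Colex (Fin n →₀ ℕ)} {p : Pn K n}
    (hp : ∀ β, coeff (ofColex β) p ≠ 0 → β ≤ α) (β : Colex (Fin n →₀ ℕ))
    (hβ : coeff (ofColex β) (D p) ≠ 0) : β < α := by
  classical
  rw [derivation_eq_sum, coeff_sum] at hβ
  obtain ⟨k, -, hk⟩ := Finset.exists_ne_zero_of_sum_ne_zero hβ
  rw [coeff_mul] at hk
  obtain ⟨⟨γ, δ⟩, hγδ, hne⟩ := Finset.exists_ne_zero_of_sum_ne_zero hk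
  rw [Finset.HasAntidiagonal.mem_antidiagonal] at hγδ
  have hγ := left_ne_zero_of_mul hne
  have hδ := right_ne_zero_of_mul hne
  rw [coeff_pderiv] at hδ
  have h₁ := hp (toColex (δ + Finsupp.single k 1)) (left_ne_zero_of_mul hδ)
  have h₂ := toColex_lt_single (mem_Psub_iff.1 (hD k) γ hγ)
  have h₃ : β = toColex δ + toColex γ := by
    rw [← toColex_add, add_comm, hγδ, toColex_ofColex]
  rw [h₃]
  exact (add_lt_add_right h₂ (toColex δ)).trans_le h₁

/-- If every unitriangular derivation maps `p` into the part of the filtration below `α`, then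
the leading exponent of `p` is at most `α`. -/
theorem toColex_le_of_coeff_derivation [CharZero K] {α : Colex (Fin n →₀ ℕ)} {p : Pn K n}
    (hp : ∀ D : DerPn K n, (∀ j : Fin n, D (X j) ∈ Psub K n j) →
      ∀ β, coeff (ofColex β) (D p) ≠ 0 → β < α) (β : Colex (Fin n →₀ ℕ))
    (hβ : coeff (ofColex β) p ≠ 0) : β ≤ α := by
  classical
  by_contra! hlt
  obtain ⟨k, heq, hk⟩ := Finsupp.Colex.lt_iff.1 hlt
  set γ : Fin n →₀ ℕ := (ofColex α).filter fun j => (j : ℕ) < k with hγ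
  have hγmem : (monomial γ 1 : Pn K n) ∈ Psub K n k :=
    monomial_mem_Psub (fun j hj => by
      by_contra h
      exact hj (Finsupp.filter_apply_neg _ _ h)) _
  have hβk : Finsupp.single k 1 ≤ ofColex β := by
    rw [Finsupp.single_le_iff]
    exact Nat.one_le_iff_ne_zero.2 (Nat.ne_zero_of_lt hk)
  have hne : coeff (γ + (ofColex β - Finsupp.single k 1)) (smulPartial k (monomial γ 1) p) ≠ 0 := by
    rw [smulPartial_apply, coeff_monomial_mul, coeff_pderiv, tsub_add_cancel_of_le hβk, one_mul]
    exact mul_ne_zero hβ (Nat.cast_add_one_ne_zero _)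
  refine (hp _ (smulPartial_X_mem_Psub hγmem)
    (toColex (γ + (ofColex β - Finsupp.single k 1))) hne).not_ge ?_
  refine Finsupp.toColex_monotone (a := ofColex α) fun j => ?_
  rcases lt_trichotomy j k with h | rfl | h
  · have : γ j = (ofColex α) j :=
      Finsupp.filter_apply_pos (fun j : Fin n => (j : ℕ) < k) _ h
    simp [this]
  · have : (ofColex α) j < (ofColex β) j := hk
    simp
    omega
  · have : (ofColex α) j = (ofColex β) j := heq j h
    simp [this, ne_of_lt h]

/-- The intertwining criterion for `Psub K n i` acted on by the unitriangular derivations. -/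
theorem surjective_of_intertwining_derivations [CharZero K] {i : ℕ}
    (f : Psub K n i →ₗ[K] Psub K n i) (hf : Function.Injective f)
    (hd : ∀ D : DerPn K n, (∀ j : Fin n, D (X j) ∈ Psub K n j) →
      ∃ D' : DerPn K n, (∀ j : Fin n, D' (X j) ∈ Psub K n j) ∧
        ∀ p q : Psub K n i, (q : Pn K n) = D' p → D (f p) = f q) :
    Function.Surjective f := by
  refine surjective_of_intertwining (A := {D : DerPn K n // ∀ j : Fin n, D (X j) ∈ Psub K n j})
    (fun β : Colex (Fin n →₀ ℕ) => (lcoeff K (ofColex β)).comp (Psub K n i).val.toLinearMap)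
    (fun p => ?_) (fun p hp => ?_)
    (fun D p => ⟨D.1 p, derivation_mem_Psub D.2 p.2⟩) (fun D α p hp => ?_)
    (fun α p hp => ?_) f hf (fun D => ?_)
  · exact (p : Pn K n).support.finite_toSet.preimage ofColex.injective.injOn |>.subset
      fun β hβ => mem_support_iff.2 hβ
  · exact Subtype.ext (MvPolynomial.ext _ _ fun m => hp (toColex m))
  · exact toColex_lt_of_coeff_derivation D.2 hp
  · exact toColex_le_of_coeff_derivation fun D hD => hp ⟨D, hD⟩
  · obtain ⟨D', hD', h⟩ := hd D.1 D.2
    exact ⟨⟨D', hD'⟩, fun p => Subtype.ext (h p _ rfl)⟩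

end Polynomials

section Unitriangular

variable {K : Type} [Field K] {n : ℕ} {L : LieSubalgebra K (DerPn K n)}

theorem mem_iff_of_toSubmodule_eq (hL : L.toSubmodule = U K n 1) {D : DerPn K n} :
    D ∈ L ↔ ∀ j : Fin n, D (X j) ∈ Psub K n j := by
  rw [← LieSubalgebra.mem_toSubmodule, hL]
  exact forall_congr' fun j => ⟨And.left, fun h => ⟨h, fun h' => by omega⟩⟩

/-- The elements of `L` killing the variables of index `< i`. -/
def killing (L : LieSubalgebra K (DerPn K n)) (i : ℕ) : Submodule K L where
  carrier := {a | ∀ j : Fin n, (j : ℕ) < i → a.1 (X j) = 0}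
  add_mem' ha hb j hj := by simp [ha j hj, hb j hj]
  zero_mem' := by simp
  smul_mem' c a ha j hj := by simp [ha j hj]

theorem mem_killing {i : ℕ} {a : L} :
    a ∈ killing L i ↔ ∀ j : Fin n, (j : ℕ) < i → a.1 (X j) = 0 := Iff.rfl

theorem killing_zero : killing L 0 = ⊤ := by
  ext a; simp [mem_killing]

theorem killing_self : killing L n = ⊥ := by
  ext a
  refine ⟨fun h => ?_, fun h => ?_⟩
  · exact Subtype.ext (derivation_ext fun j => h j j.2)
  · rw [(Submodule.mem_bot K).1 h]; exact zero_mem _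

theorem mem_killing_succ {i : Fin n} {a : L} :
    a ∈ killing L (i + 1) ↔ a ∈ killing L i ∧ a.1 (X i) = 0 := by
  simp only [mem_killing, Nat.lt_succ_iff_lt_or_eq]
  refine ⟨fun h => ⟨fun j hj => h j (.inl hj), h i (.inr rfl)⟩, fun h j hj => ?_⟩
  rcases hj with hj | hj
  · exact h.1 j hj
  · rw [Fin.ext hj]; exact h.2

theorem apply_eq_zero_of_mem_killing {i : ℕ} {a : L} (ha : a ∈ killing L i) {p : Pn K n}
    (hp : p ∈ Psub K n i) : a.1 p = 0 :=
  derivation_eq_zero_of_mem_Psub ha hp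

theorem bracket_apply (a b : L) (p : Pn K n) :
    (⁅a, b⁆ : L).1 p = a.1 (b.1 p) - b.1 (a.1 p) := by
  rw [LieSubalgebra.coe_bracket, Derivation.commutator_apply]

theorem bracket_mem_killing_succ (hL : L.toSubmodule = U K n 1) {i : ℕ} {a b : L}
    (ha : a ∈ killing L i) (hb : b ∈ killing L i) : ⁅a, b⁆ ∈ killing L (i + 1) := by
  intro j hj
  have hj' : Psub K n j ≤ Psub K n i := Psub_mono (by omega)
  rw [bracket_apply,
    apply_eq_zero_of_mem_killing ha (hj' ((mem_iff_of_toSubmodule_eq hL).1 b.2 j)),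
    apply_eq_zero_of_mem_killing hb (hj' ((mem_iff_of_toSubmodule_eq hL).1 a.2 j)), sub_zero]

/-- The element `g ∂ᵢ` of `L`, for `g` a polynomial in the variables of index `< i`. -/
def partialOf (hL : L.toSubmodule = U K n 1) (i : Fin n) : Psub K n i →ₗ[K] L :=
  ((smulPartial i).comp (Psub K n i).val.toLinearMap).codRestrict L.toSubmodule fun g =>
    (mem_iff_of_toSubmodule_eq hL).2 (smulPartial_X_mem_Psub g.2)

theorem partialOf_apply (hL : L.toSubmodule = U K n 1) (i : Fin n) (g : Psub K n i) (p : Pn K n) :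
    (partialOf hL i g).1 p = g * pderiv i p := rfl

theorem partialOf_mem_killing (hL : L.toSubmodule = U K n 1) (i : Fin n) (g : Psub K n i) :
    partialOf hL i g ∈ killing L i := fun j hj => by
  rw [partialOf_apply, pderiv_X_of_ne (by rintro rfl; exact lt_irrefl _ hj), mul_zero]

theorem exists_bracket_eq_of_mem_killing_succ [CharZero K] (hL : L.toSubmodule = U K n 1)
    {i : Fin n} {a : L} (ha : a ∈ killing L (i + 1)) :
    ∃ c ∈ killing L i, ⁅partialOf hL i 1, c⁆ = a := by
  have hex : ∀ j : Fin n, ∃ h ∈ Psub K n j, pderiv i h = a.1 (X j) ∧ ((j : ℕ) ≤ i → h = 0) := by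
    intro j
    by_cases hij : (i : ℕ) < j
    · obtain ⟨h, hmem, heq⟩ := exists_pderiv_eq hij ((mem_iff_of_toSubmodule_eq hL).1 a.2 j)
      exact ⟨h, hmem, heq, fun hle => absurd hij hle.not_gt⟩
    · exact ⟨0, zero_mem _, by rw [ha j (by omega), map_zero], fun _ => rfl⟩
  choose h hmem heq hzero using hex
  refine ⟨⟨mkDerivation K h, (mem_iff_of_toSubmodule_eq hL).2 fun j => ?_⟩, fun j hj => ?_, ?_⟩
  · rw [mkDerivation_X]; exact hmem j
  · change mkDerivation K h (X j) = 0
    rw [mkDerivation_X, hzero j hj.le]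
  · refine Subtype.ext (derivation_ext fun j => ?_)
    rw [bracket_apply, partialOf_apply, partialOf_apply]
    change _ * pderiv i (mkDerivation K h (X j)) - mkDerivation K h _ = _
    classical
    rw [mkDerivation_X, heq, pderiv_X, OneMemClass.coe_one, one_mul, one_mul]
    by_cases hij : i = j
    · subst hij; simp
    · simp [hij]

theorem map_mem_killing [CharZero K] (hL : L.toSubmodule = U K n 1) (φ : L →ₗ⁅K⁆ L) {i : ℕ}
    (hi : i ≤ n) {a : L} (ha : a ∈ killing L i) : φ a ∈ killing L i := by
  induction i generalizing a with
  | zero => simp [killing_zero]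
  | succ i ih =>
    obtain ⟨c, hc, rfl⟩ := exists_bracket_eq_of_mem_killing_succ hL (i := ⟨i, hi⟩) ha
    rw [LieHom.map_lie]
    exact bracket_mem_killing_succ hL
      (ih (by omega) (partialOf_mem_killing hL ⟨i, hi⟩ 1)) (ih (by omega) hc)

theorem mem_killing_of_forall_bracket (hL : L.toSubmodule = U K n 1) {i : Fin n} {a : L}
    (ha : ∀ b ∈ killing L i, ⁅a, b⁆ ∈ killing L (i + 1)) : a ∈ killing L i := by
  intro j hj
  have h := ha _ (partialOf_mem_killing hL i ⟨X j, X_mem_Psub hj⟩) i (Nat.lt_succ_self _)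
  rwa [bracket_apply, partialOf_apply, partialOf_apply, pderiv_X_self, mul_one,
    pderiv_eq_zero_of_mem_Psub ((mem_iff_of_toSubmodule_eq hL).1 a.2 i), mul_zero, sub_zero] at h

theorem mem_killing_of_map_mem [CharZero K] (hL : L.toSubmodule = U K n 1) (φ : L →ₗ⁅K⁆ L)
    (hφ : Function.Injective φ) {i : ℕ} (hi : i ≤ n) {a : L} (ha : φ a ∈ killing L i) :
    a ∈ killing L i := by
  induction hi using Nat.decreasingInduction generalizing a with
  | self =>
    rw [killing_self, Submodule.mem_bot] at ha ⊢
    exact hφ (ha.trans φ.map_zero.symm)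
  | of_succ i hi ih =>
    refine mem_killing_of_forall_bracket hL (i := ⟨i, hi⟩) fun b hb => ih ?_
    rw [LieHom.map_lie]
    exact bracket_mem_killing_succ hL ha (map_mem_killing hL φ hi.le hb)

theorem exists_map_sub_mem_killing [CharZero K] (hL : L.toSubmodule = U K n 1) (φ : L →ₗ⁅K⁆ L)
    (hφ : Function.Injective φ) {i : ℕ} (hi : i ≤ n) (b : L) :
    ∃ a, φ a - b ∈ killing L i := by
  induction i generalizing b with
  | zero => exact ⟨0, by simp [killing_zero]⟩
  | succ k ih =>
    let i : Fin n := ⟨k, hi⟩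
    have hsub : ∀ (a : L) (j : Fin n), a.1 (X j) ∈ Psub K n j := fun a =>
      (mem_iff_of_toSubmodule_eq hL).1 a.2
    have hker : ∀ p, φ (partialOf hL i p) ∈ killing L i := fun p =>
      map_mem_killing hL φ i.2.le (partialOf_mem_killing hL i p)
    let f : Psub K n i →ₗ[K] Psub K n i :=
      { toFun p := ⟨(φ (partialOf hL i p)).1 (X i), hsub _ i⟩
        map_add' p q := Subtype.ext (by simp)
        map_smul' c p := Subtype.ext (by simp) }
    have hf : Function.Injective f := by
      refine (injective_iff_map_eq_zero f).2 fun p hp => Subtype.ext ?_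
      have h := mem_killing_of_map_mem hL φ hφ hi
        (mem_killing_succ.2 ⟨hker p, congrArg Subtype.val hp⟩) i (Nat.lt_succ_self _)
      simpa [partialOf_apply] using h
    have hsurj : Function.Surjective f := by
      refine surjective_of_intertwining_derivations f hf fun D hD => ?_
      obtain ⟨a, ha⟩ := ih (by omega) ⟨D, (mem_iff_of_toSubmodule_eq hL).2 hD⟩
      refine ⟨a.1, hsub a, fun p q hq => ?_⟩
      have h₁ : (φ a).1 (f p : Pn K n) = D (f p) :=
        sub_eq_zero.1 (apply_eq_zero_of_mem_killing ha (f p).2)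
      have h₂ : ⁅a, partialOf hL i p⁆ - partialOf hL i q ∈ killing L (i + 1) := by
        have hz : ∀ j : Fin n, (j : ℕ) ≤ i → pderiv i (a.1 (X j)) = 0 := fun j hj =>
          pderiv_eq_zero_of_mem_Psub (Psub_mono hj (hsub a j))
        intro j hj
        change (⁅a, partialOf hL i p⁆ : L).1 (X j) - (partialOf hL i q).1 (X j) = 0
        rw [bracket_apply, partialOf_apply, partialOf_apply, partialOf_apply,
          hz j (Nat.lt_succ_iff.1 hj), hq]
        classical
        rw [pderiv_X]
        by_cases hij : i = j
        · subst hij; simp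
        · simp [hij]
      have h₃ := map_mem_killing hL φ hi h₂ i (Nat.lt_succ_self _)
      rw [map_sub, LieHom.map_lie] at h₃
      have h₄ : (⁅φ a, φ (partialOf hL i p)⁆ : L).1 (X i) = (φ (partialOf hL i q)).1 (X i) :=
        sub_eq_zero.1 h₃
      rw [bracket_apply, apply_eq_zero_of_mem_killing (hker p) (hsub _ i), sub_zero] at h₄
      exact h₁.symm.trans h₄
    obtain ⟨a, ha⟩ := ih (by omega) b
    obtain ⟨p, hp⟩ := hsurj ⟨(φ a - b).1 (X i), hsub _ i⟩
    refine ⟨a - partialOf hL i p, mem_killing_succ (i := i).2 ?_⟩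
    have hp' : (φ (partialOf hL i p)).1 (X i) = (φ a - b).1 (X i) := congrArg Subtype.val hp
    have heq : φ (a - partialOf hL i p) - b = (φ a - b) - φ (partialOf hL i p) := by
      rw [map_sub]; abel
    rw [heq]
    exact ⟨sub_mem ha (hker p), sub_eq_zero.2 hp'.symm⟩

end Unitriangular

/-- main theorem: every injective Lie algebra endomorphism of the Lie
algebra `u_n` of unitriangular polynomial derivations is an automorphism, i.e. surjective. -/
theorem monomorphism_is_automorphism (K : Type) [Field K] [CharZero K] (n : ℕ) (hn : 2 ≤ n)
    (L : LieSubalgebra K (DerPn K n)) (hL : L.toSubmodule = U K n 1)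
    (φ : L →ₗ⁅K⁆ L) (hφ : Function.Injective φ) :
    Function.Surjective φ := by
  intro b
  obtain ⟨a, ha⟩ := exists_map_sub_mem_killing hL φ hφ le_rfl b
  rw [killing_self, Submodule.mem_bot] at ha
  exact ⟨a, sub_eq_zero.1 ha⟩
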